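/- For every positive integer m, the system of equations Σ_{(b_k,...,b_1) ∈ Ξ_k} (λ_k^{b_k}/b_k!)·(λ_{k-1}^{b_{k-1}}/b_{k-1}!)···(λ_1^{b_1}/b_1!) = 1, for k = 1,...,m, has a unique real solution (λ_1,...,λ_m), and this solution satisfies λ_k > 0 for every k. -/

import Mathlib

open Finset

/-- `sumFrom b k'` is `b_k + b_{k-1} + ⋯ + b_{k'}`, where the `Fin k`-index `j`
encodes the subscript `j+1` (so `b ⟨0,_⟩ = b₁`, …, `b ⟨k-1,_⟩ = b_k`). -/
def sumFrom {k : ℕ} (b : Fin k → ℕ) (k' : ℕ) : ℕ :=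
  ∑ ℓ : Fin k, if k' ≤ ℓ.val + 1 then b ℓ else 0

/-- The set `Ξ̂_k` of non-negative integer vectors `(b_k, …, b_1)` with
`b_k + ⋯ + b_{k'} + k' ≤ k + 1` for all `1 ≤ k' ≤ k` and total sum at least `1`. -/
def XiHat (k : ℕ) : Set (Fin k → ℕ) :=
  {b | (∀ k', 1 ≤ k' → k' ≤ k → sumFrom b k' + k' ≤ k + 1) ∧ 1 ≤ ∑ ℓ, b ℓ}

/-- `Ξ_k`: vectors of `Ξ̂_k` having no proper left truncated subvector
`(b_{k'}, …, b_1)` in `Ξ̂_{k'}` for any `k' < k`. -/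
def Xi (k : ℕ) : Set (Fin k → ℕ) :=
  {b | b ∈ XiHat k ∧
    ∀ k' (h : k' < k), (fun j : Fin k' => b (Fin.castLE h.le j)) ∉ XiHat k'}

/-- The equality system `∑_{(b_k,…,b_1) ∈ Ξ_k} ∏_j λ_j^{b_j}/b_j! = 1` for `k = 1, …, m`. -/
def eqSystem (m : ℕ) (lam : ℕ → ℝ) : Prop :=
  ∀ k, 1 ≤ k → k ≤ m →
    ∑ᶠ b ∈ Xi k, ∏ j : Fin k, lam (j.val + 1) ^ (b j) / (Nat.factorial (b j)) = 1

namespace XiAux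

def T (b : ℕ → ℕ) (i : ℕ) : ℕ := ∑ j ∈ range i, b j

lemma T_zero (b : ℕ → ℕ) : T b 0 = 0 := rfl
lemma T_succ (b : ℕ → ℕ) (i : ℕ) : T b (i+1) = T b i + b i := by
  simp [T, Finset.sum_range_succ]
lemma T_mono (b : ℕ → ℕ) {i j : ℕ} (h : i ≤ j) : T b i ≤ T b j :=
  Finset.sum_le_sum_of_subset (by simpa using h)

/-- `i` is a weak record minimum of the walk, after a nonzero step. -/
def Good (b : ℕ → ℕ) (k : ℕ) : Prop := 1 ≤ T b k ∧ ∀ l ≤ k, T b k + l ≤ T b l + k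

def Q (i h : ℕ) (b : ℕ → ℕ) : Prop :=
  1 ≤ T b i ∧ (∀ k < i, ¬ Good b k) ∧ (∀ l ≤ i, T b i + l ≤ T b l + i + h) ∧
    ∃ l ≤ i, T b i + l = T b l + i + h

lemma Q_zero (h : ℕ) (b : ℕ → ℕ) : ¬ Q 0 h b := by
  rintro ⟨h1, _⟩
  simp [T_zero] at h1

lemma exists_height (i : ℕ) (b : ℕ → ℕ) :
    ∃ h, (∀ l ≤ i, T b i + l ≤ T b l + i + h) ∧ ∃ l ≤ i, T b i + l = T b l + i + h := by
  induction i with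
  | zero => exact ⟨0, by intro l hl; obtain rfl : l = 0 := by omega
                         omega, 0, le_rfl, by omega⟩
  | succ i ih =>
    obtain ⟨h, h1, l, hl, h2⟩ := ih
    have hs := T_succ b i
    by_cases hc : h + b i = 0
    · refine ⟨0, ?_, i+1, le_rfl, by omega⟩
      intro l' hl'
      rcases Nat.lt_or_ge i l' with h3 | h3
      · obtain rfl : l' = i+1 := by omega
        omega
      · have := h1 l' h3
        omega
    · refine ⟨h + b i - 1, ?_, l, by omega, by omega⟩
      intro l' hl'
      rcases Nat.lt_or_ge i l' with h3 | h3
      · obtain rfl : l' = i+1 := by omega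
        omega
      · have := h1 l' h3
        omega

lemma Q_succ (i h : ℕ) (b : ℕ → ℕ) :
    Q (i+1) h b ↔ (T b i = 0 ∧ b i = h + 1) ∨ ∃ h' ≤ h, Q i (h'+1) b ∧ b i = h - h' := by
  have hs := T_succ b i
  constructor
  · rintro ⟨h1, h2, h3, l, hl, h4⟩
    by_cases h0 : T b i = 0
    · left
      refine ⟨h0, ?_⟩
      have e1 := h3 i (by omega)
      rcases Nat.lt_or_ge i l with h5 | h5
      · obtain rfl : l = i+1 := by omega
        omega
      · have := T_mono b h5
        omega
    · right
      obtain ⟨g, g1, l', hl', g2⟩ := exists_height i b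
      have hg : g ≠ 0 := by
        rintro rfl
        exact h2 i (by omega) ⟨by omega, fun l hl => by have := g1 l hl; omega⟩
      have e1 := h3 l' (by omega)
      have e2 : g + b i = h + 1 := by
        rcases Nat.lt_or_ge i l with h5 | h5
        · obtain rfl : l = i+1 := by omega
          omega
        · have := g1 l h5
          omega
      refine ⟨g - 1, by omega, ⟨by omega, fun k hk => h2 k (by omega), ?_, l', hl', by omega⟩,
        by omega⟩
      intro l hl
      have := g1 l hl
      omega
  · rintro (⟨h0, hb⟩ | ⟨h', hh, ⟨h1, h2, h3, l, hl, h4⟩, hb⟩)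
    · refine ⟨by omega, ?_, ?_, i, by omega, by omega⟩
      · rintro k hk ⟨h1, _⟩
        have := T_mono b (show k ≤ i by omega)
        omega
      · intro l hl
        rcases Nat.lt_or_ge i l with h5 | h5
        · obtain rfl : l = i+1 := by omega
          omega
        · omega
    · refine ⟨by omega, ?_, ?_, l, by omega, by omega⟩
      · intro k hk
        rcases Nat.lt_or_ge k i with h5 | h5
        · exact h2 k h5
        · obtain rfl : k = i := by omega
          rintro ⟨_, h6⟩
          have := h6 l hl
          omega
      · intro l' hl'
        rcases Nat.lt_or_ge i l' with h5 | h5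
        · obtain rfl : l' = i+1 := by omega
          omega
        · have := h3 l' h5
          omega

/-- extension by zero -/
def ext {k : ℕ} (b : Fin k → ℕ) (j : ℕ) : ℕ := if h : j < k then b ⟨j, h⟩ else 0

lemma T_congr {b b' : ℕ → ℕ} {i : ℕ} (h : ∀ j < i, b j = b' j) : T b i = T b' i :=
  Finset.sum_congr rfl (fun j hj => h j (by simpa using hj))

lemma Good_congr {b b' : ℕ → ℕ} {i : ℕ} (h : ∀ j < i, b j = b' j) : Good b i ↔ Good b' i := by
  have : ∀ l ≤ i, T b l = T b' l := fun l hl => T_congr (fun j hj => h j (by omega))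
  unfold Good
  rw [this i le_rfl]
  refine and_congr Iff.rfl (forall₂_congr fun l hl => ?_)
  rw [this l hl]

lemma Q_congr {b b' : ℕ → ℕ} {i g : ℕ} (h : ∀ j < i, b j = b' j) : Q i g b ↔ Q i g b' := by
  have : ∀ l ≤ i, T b l = T b' l := fun l hl => T_congr (fun j hj => h j (by omega))
  unfold Q
  rw [this i le_rfl]
  refine and_congr Iff.rfl (and_congr (forall₂_congr fun l hl => ?_)
    (and_congr (forall₂_congr fun l hl => ?_) (exists_congr fun l => and_congr_right fun hl => ?_)))
  · rw [Good_congr fun j hj => h j (by omega)]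
  · rw [this l hl]
  · rw [this l hl]

lemma T_ext {k : ℕ} (b : Fin k → ℕ) : T (ext b) k = ∑ j, b j := by
  unfold T
  rw [Finset.sum_range]
  refine Finset.sum_congr rfl fun j _ => ?_
  simp [ext]

lemma sumFrom_ext {k : ℕ} (b : Fin k → ℕ) (l : ℕ) (hl : l ≤ k) :
    sumFrom b (l+1) + T (ext b) l = T (ext b) k := by
  have h1 : sumFrom b (l+1) = ∑ j ∈ range k, if l ≤ j then ext b j else 0 := by
    unfold sumFrom
    rw [Finset.sum_range]
    refine Finset.sum_congr rfl fun j _ => ?_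
    simp [ext]
  have h2 : T (ext b) l = ∑ j ∈ range k, if l ≤ j then 0 else ext b j := by
    unfold T
    have h3 : range l ⊆ range k := by simpa using hl
    rw [← Finset.sum_subset (f := fun j => if l ≤ j then 0 else ext b j) h3]
    · refine Finset.sum_congr rfl fun j hj => ?_
      rw [if_neg (by simpa using hj)]
    · intro j _ hj
      exact if_pos (by simpa using hj)
  rw [h1, h2, ← Finset.sum_add_distrib]
  unfold T
  refine Finset.sum_congr rfl fun j _ => ?_
  split_ifs <;> simp

lemma mem_XiHat {k : ℕ} (b : Fin k → ℕ) : b ∈ XiHat k ↔ Good (ext b) k := by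
  unfold XiHat Good
  rw [Set.mem_ofPred_eq, and_comm, T_ext]
  refine and_congr Iff.rfl ?_
  constructor
  · intro h l hl
    rcases Nat.lt_or_ge l k with h1 | h1
    · have e1 := h (l+1) (by omega) (by omega)
      have e2 := sumFrom_ext b l hl
      rw [T_ext] at e2
      omega
    · obtain rfl : l = k := by omega
      rw [T_ext]
  · intro h k' h1 h2
    obtain ⟨l, rfl⟩ : ∃ l, k' = l + 1 := ⟨k' - 1, by omega⟩
    have e1 := h l (by omega)
    have e2 := sumFrom_ext b l (by omega)
    rw [T_ext] at e2
    omega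

lemma mem_Xi {k : ℕ} (b : Fin k → ℕ) : b ∈ Xi k ↔ Q k 0 (ext b) := by
  unfold Xi
  rw [Set.mem_ofPred_eq, mem_XiHat]
  have : (∀ k' (h : k' < k), (fun j : Fin k' => b (Fin.castLE h.le j)) ∉ XiHat k') ↔
      ∀ k' < k, ¬ Good (ext b) k' := by
    refine forall₂_congr fun k' h => ?_
    rw [mem_XiHat]
    refine not_congr (Good_congr fun j hj => ?_)
    simp [ext, hj, hj.trans h]
  rw [this]
  unfold Good Q
  constructor
  · rintro ⟨⟨h1, h2⟩, h3⟩
    exact ⟨h1, h3, fun l hl => by have := h2 l hl; omega, k, le_rfl, by omega⟩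
  · rintro ⟨h1, h3, h2, _⟩
    exact ⟨⟨h1, fun l hl => by have := h2 l hl; omega⟩, h3⟩

/-- The finite sets of paths. -/
def C : (i : ℕ) → ℕ → Finset (Fin i → ℕ)
  | 0, _ => ∅
  | i+1, h => {Fin.snoc (α := fun _ => ℕ) (fun _ => 0) (h+1)} ∪
      (range (h+1)).biUnion fun h' =>
        (C i (h'+1)).image fun b => Fin.snoc (α := fun _ => ℕ) b (h - h')

lemma ext_last {i : ℕ} (b : Fin (i+1) → ℕ) : ext b i = b (Fin.last i) := by
  simp [ext, Fin.last]

lemma ext_init {i : ℕ} (b : Fin (i+1) → ℕ) (j : ℕ) (hj : j < i) :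
    ext b j = ext (Fin.init (α := fun _ => ℕ) b) j := by
  simp [ext, hj, Fin.init, hj.trans (Nat.lt_succ_self i)]

lemma snoc_eq_iff {i : ℕ} (b : Fin (i+1) → ℕ) (a : Fin i → ℕ) (c : ℕ) :
    Fin.snoc (α := fun _ => ℕ) a c = b ↔ a = Fin.init (α := fun _ => ℕ) b ∧ c = b (Fin.last i) := by
  constructor
  · rintro rfl
    simp
  · rintro ⟨rfl, rfl⟩
    simp

lemma mem_C (i h : ℕ) (b : Fin i → ℕ) : b ∈ C i h ↔ Q i h (ext b) := by
  induction i generalizing h with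
  | zero => simp [C, Q_zero]
  | succ i ih =>
    rw [Q_succ, C, Finset.mem_union, Finset.mem_singleton, Finset.mem_biUnion, ext_last]
    refine or_congr ?_ (exists_congr fun h' => and_congr (by simp) ?_)
    · rw [eq_comm, snoc_eq_iff, T_congr (ext_init b), T_ext, Finset.sum_eq_zero_iff]
      refine and_congr ?_ eq_comm
      rw [funext_iff]
      simp [eq_comm]
    · rw [Finset.mem_image, Q_congr (ext_init b), ← ih]
      constructor
      · rintro ⟨a, ha, he⟩
        rw [snoc_eq_iff] at he
        exact ⟨he.1 ▸ ha, he.2.symm⟩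
      · rintro ⟨ha, he⟩
        exact ⟨_, ha, (snoc_eq_iff _ _ _).2 ⟨rfl, he.symm⟩⟩

noncomputable section

def stp (l : ℝ) (s : ℕ → ℝ) (h : ℕ) : ℝ :=
  l^(h+1) / (Nat.factorial (h+1)) +
    ∑ h' ∈ range (h+1), s (h'+1) * (l^(h-h') / (Nat.factorial (h-h')))

def R (lam : ℕ → ℝ) : ℕ → ℕ → ℝ
  | 0 => fun _ => 0
  | i+1 => stp (lam (i+1)) (R lam i)

def wt (lam : ℕ → ℝ) {k : ℕ} (b : Fin k → ℕ) : ℝ :=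
  ∏ j : Fin k, lam (j.val + 1) ^ (b j) / (Nat.factorial (b j))

lemma wt_snoc (lam : ℕ → ℝ) {k : ℕ} (b : Fin k → ℕ) (c : ℕ) :
    wt lam (Fin.snoc (α := fun _ => ℕ) b c) =
      wt lam b * (lam (k+1) ^ c / (Nat.factorial c)) := by
  unfold wt
  rw [Fin.prod_univ_castSucc]
  simp

lemma sum_C (lam : ℕ → ℝ) (i h : ℕ) : ∑ b ∈ C i h, wt lam b = R lam i h := by
  induction i generalizing h with
  | zero => simp [C, R]
  | succ i ih =>
    rw [C, Finset.sum_union, Finset.sum_singleton, Finset.sum_biUnion, R, stp]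
    · congr 1
      · rw [wt_snoc]
        simp [wt]
      · refine Finset.sum_congr rfl fun h' _ => ?_
        rw [Finset.sum_image, ← ih, Finset.sum_mul]
        · exact Finset.sum_congr rfl fun b _ => wt_snoc _ _ _
        · intro a _ a' _ he
          exact ((snoc_eq_iff _ _ _).1 he).1.trans (by simp)
    · intro x hx y hy hxy
      simp only [Finset.coe_range, Set.mem_Iio] at hx hy
      refine Finset.disjoint_left.2 fun b hb hb' => ?_
      obtain ⟨a, _, ha⟩ := Finset.mem_image.1 hb
      obtain ⟨a', _, ha'⟩ := Finset.mem_image.1 hb'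
      have e1 := ((snoc_eq_iff _ _ _).1 ha).2
      have e2 := ((snoc_eq_iff _ _ _).1 ha').2
      omega
    · refine Finset.disjoint_left.2 fun b hb hb' => ?_
      rw [Finset.mem_singleton] at hb
      obtain ⟨x, _, hx⟩ := Finset.mem_biUnion.1 hb'
      obtain ⟨a', _, ha'⟩ := Finset.mem_image.1 hx
      have e1 := ((snoc_eq_iff _ _ _).1 hb.symm).2
      have e2 := ((snoc_eq_iff _ _ _).1 ha').2
      omega

lemma eqSystem_iff (m : ℕ) (lam : ℕ → ℝ) :
    eqSystem m lam ↔ ∀ k < m, lam (k+1) = 1 - R lam k 1 := by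
  have key : ∀ k, ∑ᶠ b ∈ Xi k, ∏ j : Fin k, lam (j.val + 1) ^ (b j) / (Nat.factorial (b j))
      = R lam k 0 := by
    intro k
    have : Xi k = ↑(C k 0) := by
      ext b
      rw [mem_Xi, Finset.mem_coe, mem_C]
    rw [this, finsum_mem_coe_finset, ← sum_C]
    rfl
  have h2 : ∀ k, R lam (k+1) 0 = lam (k+1) + R lam k 1 := by
    intro k
    simp [R, stp]
  unfold eqSystem
  constructor
  · intro h k hk
    have := h (k+1) (by omega) (by omega)
    rw [key, h2] at this
    linarith
  · intro h k h1 hk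
    obtain ⟨l, rfl⟩ : ∃ l, k = l + 1 := ⟨k - 1, by omega⟩
    have := h l (by omega)
    rw [key, h2]
    linarith

/-- The canonical solution states. -/
def S : ℕ → ℕ → ℝ
  | 0 => fun _ => 0
  | i+1 => stp (1 - S i 1) (S i)

lemma R_eq_S (m : ℕ) (lam : ℕ → ℝ) (h : ∀ k < m, lam (k+1) = 1 - R lam k 1) :
    ∀ k ≤ m, R lam k = S k := by
  intro k
  induction k with
  | zero => intro _; rfl
  | succ k ih =>
    intro hk
    have e := ih (by omega)
    rw [R, S, h k (by omega), e]

lemma R_eq_S' (k : ℕ) : R (fun j => 1 - S (j-1) 1) k = S k := by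
  induction k with
  | zero => rfl
  | succ k ih =>
    rw [R, S, ih]
    simp

/-- convolution with the exponential -/
def cv (s : ℕ → ℝ) (n : ℕ) (t : ℝ) : ℝ :=
  ∑ j ∈ range (n+1), s j * (t^(n-j) / (Nat.factorial (n-j)))

lemma cv_at_zero (s : ℕ → ℝ) (n : ℕ) : cv s n 0 = s n := by
  unfold cv
  rw [Finset.sum_range_succ, Finset.sum_eq_zero]
  · simp
  · intro j hj
    have : n - j ≠ 0 := by simp at hj; omega
    simp [this]

lemma cv_nonneg {s : ℕ → ℝ} (hs : ∀ n, 0 ≤ s n) (n : ℕ) {t : ℝ} (ht : 0 ≤ t) : 0 ≤ cv s n t :=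
  Finset.sum_nonneg fun j _ => mul_nonneg (hs j) (by positivity)

lemma cv_deriv_zero (s : ℕ → ℝ) (t : ℝ) : HasDerivAt (cv s 0) 0 t := by
  have : cv s 0 = fun _ => s 0 := by
    funext t
    simp [cv]
  rw [this]
  exact hasDerivAt_const _ _

lemma cv_deriv (s : ℕ → ℝ) (n : ℕ) (t : ℝ) : HasDerivAt (cv s (n+1)) (cv s n t) t := by
  have e : cv s (n+1) = fun t => (∑ j ∈ range (n+1),
      s j * (t^(n-j+1) / (Nat.factorial (n-j+1)))) + s (n+1) := by
    funext t
    unfold cv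
    rw [Finset.sum_range_succ]
    congr 1
    · refine Finset.sum_congr rfl fun j hj => ?_
      have : n + 1 - j = n - j + 1 := by simp at hj; omega
      rw [this]
    · simp
  rw [e]
  refine HasDerivAt.add_const _ ?_
  unfold cv
  refine HasDerivAt.fun_sum fun j _ => ?_
  refine HasDerivAt.const_mul _ ?_
  have h := (hasDerivAt_pow (n-j+1) t).div_const (Nat.factorial (n-j+1) : ℝ)
  convert h using 1
  rw [Nat.factorial_succ]
  push_cast
  have : (Nat.factorial (n-j) : ℝ) ≠ 0 := by positivity
  have : ((n-j : ℕ) : ℝ) + 1 ≠ 0 := by positivity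
  field_simp

/-- log-concavity -/
def LC (p : ℕ → ℝ) : Prop := ∀ a b, a ≤ b → p a * p (b+2) ≤ p (a+1) * p (b+1)

lemma nonneg_of_deriv {f f' : ℝ → ℝ} (h : ∀ t, HasDerivAt f (f' t) t) (h' : ∀ t, 0 ≤ t → 0 ≤ f' t)
    (h0 : 0 ≤ f 0) {t : ℝ} (ht : 0 ≤ t) : 0 ≤ f t := by
  have hm : MonotoneOn f (Set.Ici 0) := by
    refine monotoneOn_of_deriv_nonneg (convex_Ici 0)
      (fun x _ => (h x).continuousAt.continuousWithinAt)
      (fun x _ => (h x).differentiableAt.differentiableWithinAt) fun x hx => ?_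
    rw [(h x).deriv]
    rw [interior_Ici] at hx
    exact h' x (le_of_lt hx)
  exact h0.trans (hm (by simp) ht ht)

lemma cv_LC {s : ℕ → ℝ} (hs : ∀ n, 0 ≤ s n) (hl : LC s) :
    ∀ N a b, a + b = N → a ≤ b → ∀ t : ℝ, 0 ≤ t →
      0 ≤ cv s (a+1) t * cv s (b+1) t - cv s a t * cv s (b+2) t := by
  intro N
  induction N with
  | zero =>
    intro a b hab _ t ht
    obtain rfl : a = 0 := by omega
    obtain rfl : b = 0 := by omega
    refine nonneg_of_deriv (f := fun t => cv s (0+1) t * cv s (0+1) t - cv s 0 t * cv s (0+2) t)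
      (fun t => ((cv_deriv s 0 t).mul (cv_deriv s 0 t)).sub
        ((cv_deriv_zero s t).mul (cv_deriv s 1 t))) ?_ ?_ ht
    · intro t ht
      have := mul_nonneg (cv_nonneg hs 0 ht) (cv_nonneg hs 1 ht)
      simp only [zero_add]
      nlinarith
    · simp only [cv_at_zero]
      have := hl 0 0 le_rfl
      linarith
  | succ N ih =>
    intro a b hab hle t ht
    obtain ⟨b, rfl⟩ : ∃ c, b = c + 1 := ⟨b - 1, by omega⟩
    have h0 : 0 ≤ cv s (a+1) 0 * cv s (b+1+1) 0 - cv s a 0 * cv s (b+1+2) 0 := by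
      simp only [cv_at_zero]
      have := hl a (b+1) hle
      linarith
    have hfirst : ∀ t : ℝ, 0 ≤ t →
        0 ≤ cv s (a+1) t * cv s (b+1) t - cv s a t * cv s (b+2) t := by
      intro t ht
      rcases Nat.lt_or_ge b a with h | h
      · obtain rfl : a = b + 1 := by omega
        apply le_of_eq
        ring
      · exact ih a b (by omega) h t ht
    rcases a with _ | a
    · refine nonneg_of_deriv
        (f := fun t => cv s (0+1) t * cv s (b+1+1) t - cv s 0 t * cv s (b+1+2) t)
        (fun t => ((cv_deriv s 0 t).mul (cv_deriv s (b+1) t)).sub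
          ((cv_deriv_zero s t).mul (cv_deriv s (b+2) t))) ?_ h0 ht
      intro t ht
      have := mul_nonneg (cv_nonneg hs 1 ht) (cv_nonneg hs (b+1) ht)
      simp only [zero_add]
      have e : b + 1 + 1 = b + 2 := rfl
      rw [e]
      linarith
    · refine nonneg_of_deriv
        (f := fun t => cv s (a+1+1) t * cv s (b+1+1) t - cv s (a+1) t * cv s (b+1+2) t)
        (fun t => ((cv_deriv s (a+1) t).mul (cv_deriv s (b+1) t)).sub
          ((cv_deriv s a t).mul (cv_deriv s (b+2) t))) ?_ h0 ht
      intro t ht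
      have h1 := hfirst t ht
      have h2 := ih a (b+1) (by omega) (by omega) t ht
      have e : b + 1 + 1 = b + 2 := rfl
      have e' : b + 1 + 2 = b + 3 := rfl
      have e'' : b + 2 + 1 = b + 3 := rfl
      simp only [e, e', e''] at h1 h2 ⊢
      linarith

/-- the state with its zeroth entry normalised to 1 -/
def g (k n : ℕ) : ℝ := if n = 0 then 1 else S k n

lemma stp_eq_cv (k h : ℕ) (l : ℝ) : stp l (S k) h = cv (g k) (h+1) l := by
  unfold stp cv
  rw [Finset.sum_range_succ' _ (h+1), add_comm (l^(h+1) / _)]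
  congr 1
  · refine Finset.sum_congr rfl fun j _ => ?_
    simp [g]
  · simp [g]

lemma g_succ (k n : ℕ) : g (k+1) n = cv (g k) (n+1) (1 - g k 1) := by
  have h1 : g k 1 = S k 1 := by simp [g]
  rw [← stp_eq_cv, h1, g]
  split_ifs with h
  · subst h
    simp [stp]
  · rfl

lemma invariant (k : ℕ) : (∀ n, 0 ≤ g k n) ∧ LC (g k) ∧ g k 1 < 1 := by
  induction k with
  | zero =>
    refine ⟨?_, ?_, ?_⟩
    · intro n
      simp only [g, S]
      split_ifs <;> norm_num
    · intro a b _
      simp [g, S]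
    · simp [g, S]
  | succ k ih =>
    obtain ⟨h1, h2, h3⟩ := ih
    have hl : 0 ≤ 1 - g k 1 := by linarith
    refine ⟨fun n => ?_, fun a b hab => ?_, ?_⟩
    · rw [g_succ]
      exact cv_nonneg h1 _ hl
    · simp only [g_succ]
      have := cv_LC h1 h2 _ (a+1) (b+1) rfl (by omega) _ hl
      linarith
    · rw [g_succ]
      have e0 : g k 0 = 1 := by simp [g]
      have e2 := h2 0 0 le_rfl
      have e1 := h1 1
      simp [cv, Finset.sum_range_succ, e0] at e2 ⊢
      nlinarith

end

end XiAux

/-- For every positive integer `m`, the system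
`∑_{(b_k,…,b_1) ∈ Ξ_k} ∏_j λ_j^{b_j}/b_j! = 1` (`k = 1,…,m`) has a solution,
the solution is unique (on the relevant coordinates `1,…,m`), and every
solution satisfies `λ_k > 0` for all `k ∈ {1,…,m}`. -/
theorem eqSystem_exists_unique_pos (m : ℕ) (hm : 1 ≤ m) :
    (∃ lam : ℕ → ℝ, eqSystem m lam) ∧
    (∀ lam lam' : ℕ → ℝ, eqSystem m lam → eqSystem m lam' →
      ∀ k, 1 ≤ k → k ≤ m → lam k = lam' k) ∧
    (∀ lam : ℕ → ℝ, eqSystem m lam → ∀ k, 1 ≤ k → k ≤ m → 0 < lam k) := by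
  have hpos : ∀ k, 0 < 1 - XiAux.S k 1 := by
    intro k
    have := (XiAux.invariant k).2.2
    simp [XiAux.g] at this
    linarith
  have hsol : ∀ lam : ℕ → ℝ, eqSystem m lam → ∀ k, 1 ≤ k → k ≤ m →
      lam k = 1 - XiAux.S (k-1) 1 := by
    intro lam h k h1 hk
    rw [XiAux.eqSystem_iff] at h
    obtain ⟨l, rfl⟩ : ∃ l, k = l + 1 := ⟨k - 1, by omega⟩
    rw [h l (by omega), XiAux.R_eq_S m lam h l (by omega)]
    rfl
  refine ⟨⟨fun j => 1 - XiAux.S (j-1) 1, ?_⟩, ?_, ?_⟩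
  · rw [XiAux.eqSystem_iff]
    intro k _
    rw [XiAux.R_eq_S']
    rfl
  · intro lam lam' h h' k h1 hk
    rw [hsol lam h k h1 hk, hsol lam' h' k h1 hk]
  · intro lam h k h1 hk
    rw [hsol lam h k h1 hk]
    exact hpos _
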